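/- Let d ≥ 1, let u : ℝᵈ → ℝ be continuous and ℤᵈ-periodic, and let g : ℝᵈ → ℝ be C¹ and ℤᵈ-periodic. Suppose that for every h ∈ ℝᵈ one has (1/2) ∫ (u(x+h) − u(x))² dx ≤ ∫ g(x) (u(x) − u(x+h)) dx (integrals in x over [0,1)ᵈ). Then for every h ∈ ℝᵈ, (∫ (u(x+h) − u(x))² dx)^{1/2} ≤ 2 (∫ |∇g|²)^{1/2} |h|. -/

import Mathlib

open MeasureTheory
open scoped RealInnerProductSpace

noncomputable section

/-- The fundamental domain `[0,1)^d` of the torus, inside `ℝ^d`. -/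
def UnitCube (d : ℕ) : Set (EuclideanSpace ℝ (Fin d)) :=
  {x | ∀ i, 0 ≤ x i ∧ x i < 1}

/-- A function on `ℝ^d` is `ℤ^d`-periodic if it is invariant under translations by
integer vectors. -/
def ZdPeriodic {d : ℕ} {V : Type*} (f : EuclideanSpace ℝ (Fin d) → V) : Prop :=
  ∀ (x : EuclideanSpace ℝ (Fin d)) (m : Fin d → ℤ),
    f (x + (EuclideanSpace.equiv (Fin d) ℝ).symm (fun i => (m i : ℝ))) = f x

/-- The divergence of a vector field on `ℝ^d`. -/
noncomputable def diverg {d : ℕ}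
    (z : EuclideanSpace ℝ (Fin d) → EuclideanSpace ℝ (Fin d))
    (x : EuclideanSpace ℝ (Fin d)) : ℝ :=
  ∑ i, fderiv ℝ z x (EuclideanSpace.single i 1) i


lemma cube_eq (d : ℕ) : UnitCube d =
    ZSpan.fundamentalDomain (EuclideanSpace.basisFun (Fin d) ℝ).toBasis := by
  ext x
  simp [UnitCube, ZSpan.mem_fundamentalDomain]

lemma cube_meas (d : ℕ) : MeasurableSet (UnitCube d) := by
  rw [cube_eq]; exact ZSpan.fundamentalDomain_measurableSet _

lemma cube_bdd (d : ℕ) : Bornology.IsBounded (UnitCube d) := by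
  rw [cube_eq]; exact ZSpan.fundamentalDomain_isBounded _

lemma cube_int {d : ℕ} {F : EuclideanSpace ℝ (Fin d) → ℝ} (hF : Continuous F) :
    IntegrableOn F (UnitCube d) :=
  (hF.continuousOn.integrableOn_compact (cube_bdd d).isCompact_closure).mono_set subset_closure

open scoped Pointwise in
lemma cube_shift {d : ℕ} {F : EuclideanSpace ℝ (Fin d) → ℝ} (hF : ZdPeriodic F)
    (h : EuclideanSpace ℝ (Fin d)) :
    ∫ x in UnitCube d, F (x + h) = ∫ x in UnitCube d, F x := by
  rw [cube_eq]
  set b := (EuclideanSpace.basisFun (Fin d) ℝ).toBasis with hb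
  have fd := ZSpan.isAddFundamentalDomain b volume
  have fd2 : IsAddFundamentalDomain (Submodule.span ℤ (Set.range b))
      (h +ᵥ ZSpan.fundamentalDomain b) volume := fd.vadd_of_comm h
  have hinv : ∀ (v : Submodule.span ℤ (Set.range b)) x, F (v +ᵥ x) = F x := by
    intro v x
    have hm := (b.mem_span_iff_repr_mem ℤ (v : EuclideanSpace ℝ (Fin d))).1 v.2
    choose m hm using hm
    rw [← hF x m]
    congr 1
    rw [Submodule.vadd_def, vadd_eq_add, add_comm]
    congr 1
    ext i
    have := hm i
    simp [hb] at this
    simp [this]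
  have : VAddInvariantMeasure (Submodule.span ℤ (Set.range b))
      (EuclideanSpace ℝ (Fin d)) volume :=
    ⟨fun c s _ => measure_preimage_add volume (c : EuclideanSpace ℝ (Fin d)) s⟩
  rw [fd.setIntegral_eq fd2 hinv]
  have hmp : MeasurePreserving (fun x : EuclideanSpace ℝ (Fin d) => x + h) volume volume :=
    measurePreserving_add_right volume h
  have := hmp.setIntegral_image_emb (measurableEmbedding_addRight h) F (ZSpan.fundamentalDomain b)
  rw [← this]
  congr 2
  ext x
  simp only [Set.mem_vadd_set, Set.mem_image, vadd_eq_add, add_comm h]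

lemma grad_bound {d : ℕ} {g : EuclideanSpace ℝ (Fin d) → ℝ}
    (hg : ContDiff ℝ 1 g) (hgper : ZdPeriodic g) (h : EuclideanSpace ℝ (Fin d)) :
    ∫ x in UnitCube d, (g (x + h) - g x) ^ 2 ≤
      (∫ x in UnitCube d, ‖gradient g x‖ ^ 2) * ‖h‖ ^ 2 := by
  have hgc := hg.continuous
  have hgd : Differentiable ℝ g := hg.differentiable one_ne_zero
  have hnorm : ∀ x, ‖gradient g x‖ = ‖fderiv ℝ g x‖ := fun x => by simp [gradient]
  simp only [hnorm]
  have hfc : Continuous (fderiv ℝ g) := hg.continuous_fderiv one_ne_zero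
  have hper : ZdPeriodic (fun x => ‖fderiv ℝ g x‖ ^ 2) := by
    intro x m
    have : fderiv ℝ g (x + (EuclideanSpace.equiv (Fin d) ℝ).symm (fun i => (m i : ℝ)))
        = fderiv ℝ g x := by
      rw [← fderiv_comp_add_right]
      congr 1
      funext y
      exact hgper y m
    simp only [this]
  have pt : ∀ x, (g (x + h) - g x) ^ 2 ≤
      ∫ t in Set.Ioc (0:ℝ) 1, ‖fderiv ℝ g (x + t • h)‖ ^ 2 * ‖h‖ ^ 2 := by
    intro x
    have hc : Continuous (fun t : ℝ => fderiv ℝ g (x + t • h) h) := by fun_prop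
    have hc2 : Continuous (fun t : ℝ => ‖fderiv ℝ g (x + t • h)‖ ^ 2 * ‖h‖ ^ 2) := by fun_prop
    have ftc : ∫ t in (0:ℝ)..1, fderiv ℝ g (x + t • h) h = g (x + h) - g x := by
      have := intervalIntegral.integral_eq_sub_of_hasDerivAt (a := 0) (b := 1)
        (f := fun t : ℝ => g (x + t • h)) (f' := fun t => fderiv ℝ g (x + t • h) h) ?_
        (hc.intervalIntegrable _ _)
      · simpa using this
      · intro t _
        have h1 : HasDerivAt (fun t : ℝ => x + t • h) h t := by
          simpa using ((hasDerivAt_id t).smul_const h).const_add x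
        exact (hgd _).hasFDerivAt.comp_hasDerivAt t h1
    set D := g (x + h) - g x
    have key : ∫ t in (0:ℝ)..1, (2 * D * fderiv ℝ g (x + t • h) h - D ^ 2) ≤
        ∫ t in (0:ℝ)..1, ‖fderiv ℝ g (x + t • h)‖ ^ 2 * ‖h‖ ^ 2 := by
      apply intervalIntegral.integral_mono_on zero_le_one
      · exact (by fun_prop : Continuous _).intervalIntegrable _ _
      · exact hc2.intervalIntegrable _ _
      · intro t _
        have h1 := (fderiv ℝ g (x + t • h)).le_opNorm h
        have h2 : (fderiv ℝ g (x + t • h) h) ^ 2 ≤ (‖fderiv ℝ g (x + t • h)‖ * ‖h‖) ^ 2 := by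
          rw [← sq_abs]; exact pow_le_pow_left₀ (abs_nonneg _) h1 2
        nlinarith [sq_nonneg (fderiv ℝ g (x + t • h) h - D)]
    rw [intervalIntegral.integral_sub ((hc.const_mul _).intervalIntegrable _ _)
      (by simp), intervalIntegral.integral_const_mul, ftc] at key
    rw [← intervalIntegral.integral_of_le zero_le_one]
    simp at key
    simp
    nlinarith
  have hFc : Continuous (Function.uncurry fun (x : EuclideanSpace ℝ (Fin d)) (t : ℝ) =>
      ‖fderiv ℝ g (x + t • h)‖ ^ 2 * ‖h‖ ^ 2) := by
    unfold Function.uncurry; fun_prop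
  have hFi : Integrable (Function.uncurry fun (x : EuclideanSpace ℝ (Fin d)) (t : ℝ) =>
      ‖fderiv ℝ g (x + t • h)‖ ^ 2 * ‖h‖ ^ 2)
      ((volume.restrict (UnitCube d)).prod (volume.restrict (Set.Ioc (0:ℝ) 1))) := by
    rw [Measure.prod_restrict]
    exact (hFc.continuousOn.integrableOn_compact
      ((cube_bdd d).isCompact_closure.prod isCompact_Icc)).mono_set
      (Set.prod_mono subset_closure Set.Ioc_subset_Icc_self)
  calc ∫ x in UnitCube d, (g (x + h) - g x) ^ 2
      ≤ ∫ x in UnitCube d, ∫ t in Set.Ioc (0:ℝ) 1, ‖fderiv ℝ g (x + t • h)‖ ^ 2 * ‖h‖ ^ 2 :=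
        integral_mono (cube_int (by fun_prop)) hFi.integral_prod_left pt
    _ = ∫ t in Set.Ioc (0:ℝ) 1, ∫ x in UnitCube d, ‖fderiv ℝ g (x + t • h)‖ ^ 2 * ‖h‖ ^ 2 :=
        integral_integral_swap hFi
    _ = ∫ t in Set.Ioc (0:ℝ) 1, (∫ x in UnitCube d, ‖fderiv ℝ g x‖ ^ 2) * ‖h‖ ^ 2 := by
        congr 1
        funext t
        rw [integral_mul_const]
        congr 1
        exact cube_shift hper (t • h)
    _ = _ := by simp

/-- regularity-via-duality translation argument, Proposition 4.2: if
for every `h` one has `½ ∫ (u(x+h) - u(x))² ≤ ∫ g(x)(u(x) - u(x+h))`, then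
`‖u(·+h) - u‖_{L²} ≤ 2 ‖∇g‖_{L²} |h|` for every `h`. -/
theorem translation_difference_quotient_bound (d : ℕ) (hd : 1 ≤ d)
    (u g : EuclideanSpace ℝ (Fin d) → ℝ)
    (hu : Continuous u) (huper : ZdPeriodic u)
    (hg : ContDiff ℝ 1 g) (hgper : ZdPeriodic g)
    (hyp : ∀ h : EuclideanSpace ℝ (Fin d),
      (1 / 2) * ∫ x in UnitCube d, (u (x + h) - u x) ^ 2 ≤
        ∫ x in UnitCube d, g x * (u x - u (x + h))) :
    ∀ h : EuclideanSpace ℝ (Fin d),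
      Real.sqrt (∫ x in UnitCube d, (u (x + h) - u x) ^ 2) ≤
        2 * Real.sqrt (∫ x in UnitCube d, ‖gradient g x‖ ^ 2) * ‖h‖ := by
  intro h
  have hgc := hg.continuous
  have uper : ∀ (x : EuclideanSpace ℝ (Fin d)) (m : Fin d → ℤ) k,
      u (x + (EuclideanSpace.equiv (Fin d) ℝ).symm (fun i => (m i : ℝ)) + k) = u (x + k) := by
    intro x m k
    rw [add_right_comm]; exact huper _ m
  have e1 : ∫ x in UnitCube d, (u (x + -h) - u x) ^ 2 =
      ∫ x in UnitCube d, (u (x + h) - u x) ^ 2 := by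
    rw [← cube_shift (F := fun x => (u (x + -h) - u x) ^ 2) ?_ h]
    · congr 1; funext x; simp only [add_neg_cancel_right]; ring
    · intro x m
      simp only [uper, huper x m]
  have e2 : ∫ x in UnitCube d, g x * (u x - u (x + -h)) =
      ∫ x in UnitCube d, g (x + h) * (u (x + h) - u x) := by
    rw [← cube_shift (F := fun x => g x * (u x - u (x + -h))) ?_ h]
    · simp only [add_neg_cancel_right]
    · intro x m
      simp only [uper, huper x m, hgper x m]
  have h1 := hyp h
  have h2 := hyp (-h)
  rw [e1, e2] at h2
  have h3 : (∫ x in UnitCube d, g x * (u x - u (x + h))) +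
      ∫ x in UnitCube d, g (x + h) * (u (x + h) - u x) ≤
      ∫ x in UnitCube d, ((1/2) * (g (x + h) - g x) ^ 2 + (1/2) * (u (x + h) - u x) ^ 2) := by
    rw [← integral_add (cube_int (by fun_prop)) (cube_int (by fun_prop))]
    apply integral_mono
    · exact cube_int (by fun_prop)
    · exact cube_int (by fun_prop)
    · intro x
      simp only
      nlinarith [sq_nonneg ((g (x + h) - g x) - (u (x + h) - u x))]
  rw [integral_add (cube_int (by fun_prop)) (cube_int (by fun_prop)), integral_const_mul,
    integral_const_mul] at h3
  have h4 := grad_bound hg hgper h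
  have h5 : ∫ x in UnitCube d, (u (x + h) - u x) ^ 2 ≤
      (∫ x in UnitCube d, ‖gradient g x‖ ^ 2) * ‖h‖ ^ 2 := by linarith
  have h6 := Real.sqrt_le_sqrt h5
  have hG : 0 ≤ ∫ x in UnitCube d, ‖gradient g x‖ ^ 2 := integral_nonneg fun x => by positivity
  rw [Real.sqrt_mul hG, Real.sqrt_sq (norm_nonneg h)] at h6
  have : 0 ≤ √(∫ x in UnitCube d, ‖gradient g x‖ ^ 2) * ‖h‖ := by positivity
  linarith

end
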